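/- Let C be a symmetric rigid monoidal category over a field k with symmetry c and End(1) = k, let X be an object of C of dimension d := ẽv_X ∘ coev_X ∈ k, and let m ≥ 1. Then for every σ ∈ S_m, Tr^{X^{⊗(m-1)}}_{X,X}(ρ(σ)) = d^{N(σ)-1} · id_X, where N(σ) denotes the number of disjoint cycles of σ acting on {1,…,m} (fixed points counted as cycles). -/

import Mathlib

open CategoryTheory MonoidalCategory

variable {C : Type*} [Category C] [MonoidalCategory C]

/-- The `n`-th tensor power `X^{⊗n}` of an object of a monoidal category. -/
def tpow (X : C) : ℕ → C
  | 0 => 𝟙_ C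
  | n + 1 => X ⊗ tpow X n

/-- The braiding of the `i`-th and `(i+1)`-th tensor factors of `X^{⊗m}`
(positions `0`-indexed). -/
def adjSwap [BraidedCategory C] (X : C) : (m : ℕ) → ℕ → (tpow X m ⟶ tpow X m)
  | 0, _ => 𝟙 _
  | 1, _ => 𝟙 _
  | m + 2, 0 =>
      (α_ X X (tpow X m)).inv ≫ ((β_ X X).hom ▷ tpow X m) ≫ (α_ X X (tpow X m)).hom
  | m + 2, i + 1 => X ◁ adjSwap X (m + 1) i

/-- `ρ : S_m →* End (X^{⊗m})` is *the* action of the symmetric group permuting the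
tensor factors via the symmetry iff it sends each adjacent transposition `(i, i+1)` to
the braiding of the corresponding adjacent tensor factors (these transpositions generate
`S_m`, so this characterizes the action uniquely). -/
def IsPermAction [BraidedCategory C] (X : C) (m : ℕ)
    (ρ : Equiv.Perm (Fin m) →* CategoryTheory.End (tpow X m)) : Prop :=
  ∀ (i : ℕ) (h : i + 1 < m),
    ρ (Equiv.swap ⟨i, Nat.lt_of_succ_lt h⟩ ⟨i + 1, h⟩) = adjSwap X m i

/-- The partial trace `Tr^U_{A,B}(f) := (id_B ⊗ ẽv_U) ∘ (f ⊗ id_{U*}) ∘ (id_A ⊗ coev_U)`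
of `f : A ⊗ U ⟶ B ⊗ U` in a symmetric rigid monoidal category, where
`ẽv_U := ev_U ∘ c_{U,U*}`. -/
def ptrace [SymmetricCategory C] [RigidCategory C] (A B U : C) (f : A ⊗ U ⟶ B ⊗ U) :
    A ⟶ B :=
  (ρ_ A).inv ≫ (A ◁ η_ U (Uᘁ)) ≫ (α_ A U (Uᘁ)).inv ≫ (f ▷ (Uᘁ)) ≫
    (α_ B U (Uᘁ)).hom ≫ (B ◁ ((β_ U (Uᘁ)).hom ≫ ε_ U (Uᘁ))) ≫ (ρ_ B).hom
/-- The number of disjoint cycles of a permutation of `Fin m`, counting fixed points as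
cycles (i.e. the number of orbits): the number of nontrivial cycles plus the number of
fixed points. -/
def numCycles {m : ℕ} (σ : Equiv.Perm (Fin m)) : ℕ :=
  Multiset.card σ.cycleType + (m - σ.cycleType.sum)

section LeftTrace

open BraidedCategory ExactPairing

variable [SymmetricCategory C]

/-- The left partial trace of `h : U ⊗ W ⟶ U ⊗ W'`, closing up the strand `U` by means of an
exact pairing of `U` with `V`. -/
def leftTrace {U : C} (V : C) [ExactPairing U V] {W W' : C} (h : U ⊗ W ⟶ U ⊗ W') : W ⟶ W' :=
  (λ_ W).inv ≫ (η_ U V ≫ (β_ U V).hom) ▷ W ≫ (α_ V U W).hom ≫ V ◁ h ≫ (α_ V U W').inv ≫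
    ε_ U V ▷ W' ≫ (λ_ W').hom

lemma leftTrace_whiskerLeft_comp {U V : C} [ExactPairing U V] {W W' W'' : C} (g : W ⟶ W')
    (h : U ⊗ W' ⟶ U ⊗ W'') : leftTrace V (U ◁ g ≫ h) = g ≫ leftTrace V h := by
  simp only [leftTrace, MonoidalCategory.whiskerLeft_comp, Category.assoc]
  rw [← associator_naturality_right_assoc, ← whisker_exchange_assoc,
    ← leftUnitor_inv_naturality_assoc]

lemma leftTrace_comp_whiskerLeft {U V : C} [ExactPairing U V] {W W' W'' : C}
    (h : U ⊗ W ⟶ U ⊗ W') (g : W' ⟶ W'') : leftTrace V (h ≫ U ◁ g) = leftTrace V h ≫ g := by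
  simp only [leftTrace, MonoidalCategory.whiskerLeft_comp, Category.assoc]
  rw [associator_inv_naturality_right_assoc, whisker_exchange_assoc, leftUnitor_naturality]

lemma leftTrace_whiskerRight {U V : C} [ExactPairing U V] {W W' : C}
    (h : U ⊗ W ⟶ U ⊗ W') (Z : C) :
    leftTrace V ((α_ U W Z).inv ≫ h ▷ Z ≫ (α_ U W' Z).hom) = leftTrace V h ▷ Z := by
  simp only [leftTrace]
  monoidal

lemma leftTrace_id (U V W : C) [ExactPairing U V] :
    leftTrace V (𝟙 (U ⊗ W)) =
      (λ_ W).inv ≫ (η_ U V ≫ (β_ U V).hom ≫ ε_ U V) ▷ W ≫ (λ_ W).hom := by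
  simp [leftTrace]

lemma leftTrace_braiding (U V : C) [ExactPairing U V] :
    leftTrace V (β_ U U).hom = 𝟙 U := by
  have h : (β_ U V).hom ▷ U ≫ (α_ V U U).hom ≫ V ◁ (β_ U U).hom ≫ (α_ V U U).inv =
      (α_ U V U).hom ≫ (β_ U (V ⊗ U)).hom := by
    simp [braiding_tensor_right_hom]
  simp only [leftTrace, comp_whiskerRight, Category.assoc]
  rw [reassoc_of% h, ← braiding_naturality_right_assoc, braiding_leftUnitor,
    ExactPairing.evaluation_coevaluation_assoc]
  simp

/-- The left trace does not depend on the choice of a dual. -/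
lemma leftTrace_eq_of_exactPairing {U V V' : C} (p : ExactPairing U V) (p' : ExactPairing U V')
    {W W' : C} (h : U ⊗ W ⟶ U ⊗ W') :
    @leftTrace _ _ _ _ U V p _ _ h = @leftTrace _ _ _ _ U V' p' _ _ h := by
  obtain ⟨φ, hη, hε⟩ : ∃ φ : V' ⟶ V,
      @coevaluation _ _ _ U V p = @coevaluation _ _ _ U V' p' ≫ U ◁ φ ∧
      φ ▷ U ≫ @evaluation _ _ _ U V p = @evaluation _ _ _ U V' p' :=
    ⟨@rightAdjointMate _ _ _ U U ⟨V⟩ ⟨V'⟩ (𝟙 U), by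
      simpa using (@coevaluation_comp_rightAdjointMate _ _ _ U U ⟨V⟩ ⟨V'⟩ (𝟙 U)).symm, by
      simpa using @rightAdjointMate_comp_evaluation _ _ _ U U ⟨V⟩ ⟨V'⟩ (𝟙 U)⟩
  simp only [leftTrace, hη, ← hε, Category.assoc, braiding_naturality_right, comp_whiskerRight]
  rw [associator_naturality_left_assoc, ← whisker_exchange_assoc,
    associator_inv_naturality_left_assoc]

lemma whiskerLeft_braiding_whiskerRight {P Q : C} (ξ : 𝟙_ C ⟶ P ⊗ Q) (A : C) :
    A ◁ ξ ≫ (α_ A P Q).inv ≫ (β_ A P).hom ▷ Q =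
      (ρ_ A).hom ≫ (λ_ A).inv ≫ ξ ▷ A ≫ (α_ P Q A).hom ≫ P ◁ (β_ Q A).hom ≫ (α_ P A Q).inv := by
  have h := braiding_naturality_left ξ A
  rw [braiding_tensorUnit_left, braiding_tensor_left_hom] at h
  rw [← cancel_epi ((λ_ A).hom ≫ (ρ_ A).inv)]
  simp only [Category.assoc] at h ⊢
  rw [← reassoc_of% h, Iso.hom_inv_id_assoc, ← comp_whiskerRight, SymmetricCategory.symmetry]
  simp

lemma braiding_whiskerRight_whiskerLeft {P Q : C} (ζ : P ⊗ Q ⟶ 𝟙_ C) (B : C) :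
    (β_ P B).hom ▷ Q ≫ (α_ B P Q).hom ≫ B ◁ ζ =
      (α_ P B Q).hom ≫ P ◁ (β_ B Q).hom ≫ (α_ P Q B).inv ≫ ζ ▷ B ≫ (λ_ B).hom ≫ (ρ_ B).inv := by
  have h := braiding_naturality_left ζ B
  rw [braiding_tensorUnit_left, braiding_tensor_left_hom] at h
  rw [h]
  simp only [Category.assoc, Iso.inv_hom_id_assoc]
  rw [← MonoidalCategory.whiskerLeft_comp_assoc, SymmetricCategory.symmetry]
  simp

lemma coevaluation_tensor_braiding (U₁ U₂ V₁ V₂ : C) [ExactPairing U₁ V₁] [ExactPairing U₂ V₂] :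
    η_ (U₁ ⊗ U₂) (V₂ ⊗ V₁) ≫ (β_ (U₁ ⊗ U₂) (V₂ ⊗ V₁)).hom =
      (η_ U₂ V₂ ≫ (β_ U₂ V₂).hom) ≫
        V₂ ◁ ((λ_ U₂).inv ≫ (η_ U₁ V₁ ≫ (β_ U₁ V₁).hom) ▷ U₂ ≫ (α_ V₁ U₁ U₂).hom) ≫
          (α_ V₂ V₁ (U₁ ⊗ U₂)).inv := by
  have h := braiding_naturality_right U₂ (η_ U₁ V₁)
  rw [braiding_tensorUnit_right, braiding_tensor_right_hom] at h
  have h₁ : η_ U₁ V₁ ▷ U₂ = 𝟙 _ ⊗≫ U₂ ◁ η_ U₁ V₁ ⊗≫ (β_ U₂ U₁).hom ▷ V₁ ⊗≫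
      U₁ ◁ (β_ U₂ V₁).hom ⊗≫ 𝟙 _ := by
    rw [← cancel_epi ((ρ_ U₂).hom ≫ (λ_ U₂).inv), ← h]
    monoidal
  set ξ := η_ U₂ V₂ ≫ (β_ U₂ V₂).hom with hξ
  calc
    _ = η_ U₁ V₁ ⊗≫ (U₁ ◁ ξ) ▷ V₁ ⊗≫ ((U₁ ⊗ V₂) ◁ (β_ U₂ V₁).hom ≫
          (β_ U₁ V₂).hom ▷ (V₁ ⊗ U₂)) ⊗≫ V₂ ◁ (β_ U₁ V₁).hom ▷ U₂ ⊗≫ 𝟙 _ := by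
      rw [tensor_coevaluation, braiding_tensor_left_hom, braiding_tensor_right_hom,
        braiding_tensor_right_hom, hξ]
      monoidal
    _ = η_ U₁ V₁ ⊗≫ (U₁ ◁ ξ ≫ (α_ _ _ _).inv ≫ (β_ U₁ V₂).hom ▷ U₂) ▷ V₁ ⊗≫
          (V₂ ⊗ U₁) ◁ (β_ U₂ V₁).hom ⊗≫ V₂ ◁ (β_ U₁ V₁).hom ▷ U₂ ⊗≫ 𝟙 _ := by
      rw [whisker_exchange]
      monoidal
    _ = 𝟙 _ ⊗≫ (𝟙_ C ◁ η_ U₁ V₁ ≫ ξ ▷ (U₁ ⊗ V₁)) ⊗≫ V₂ ◁ (β_ U₂ U₁).hom ▷ V₁ ⊗≫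
          (V₂ ⊗ U₁) ◁ (β_ U₂ V₁).hom ⊗≫ V₂ ◁ (β_ U₁ V₁).hom ▷ U₂ ⊗≫ 𝟙 _ := by
      rw [whiskerLeft_braiding_whiskerRight]
      monoidal
    _ = ξ ≫ V₂ ◁ ((λ_ U₂).inv ≫ (𝟙 _ ⊗≫ U₂ ◁ η_ U₁ V₁ ⊗≫ (β_ U₂ U₁).hom ▷ V₁ ⊗≫
          U₁ ◁ (β_ U₂ V₁).hom ⊗≫ 𝟙 _) ≫ (β_ U₁ V₁).hom ▷ U₂ ≫ (α_ V₁ U₁ U₂).hom) ≫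
          (α_ V₂ V₁ (U₁ ⊗ U₂)).inv := by
      rw [whisker_exchange]
      monoidal
    _ = _ := by rw [← h₁, hξ, comp_whiskerRight]; simp only [Category.assoc]

lemma leftTrace_tensor {U₁ U₂ V₁ V₂ : C} [ExactPairing U₁ V₁] [ExactPairing U₂ V₂] {W W' : C}
    (h : (U₁ ⊗ U₂) ⊗ W ⟶ (U₁ ⊗ U₂) ⊗ W') :
    leftTrace (V₂ ⊗ V₁) h =
      leftTrace V₂ (leftTrace V₁ ((α_ U₁ U₂ W).inv ≫ h ≫ (α_ U₁ U₂ W').hom)) := by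
  simp only [leftTrace, coevaluation_tensor_braiding, ExactPairing.tensor_evaluation]
  monoidal

variable [RigidCategory C]

lemma ptrace_eq_leftTrace (A B U : C) (f : A ⊗ U ⟶ B ⊗ U) :
    ptrace A B U f = leftTrace (Uᘁ : C) ((β_ U A).hom ≫ f ≫ (β_ B U).hom) := by
  have hf : f ▷ (Uᘁ : C) = (β_ (A ⊗ U) (Uᘁ)).hom ≫ (Uᘁ : C) ◁ f ≫ (β_ (Uᘁ) (B ⊗ U)).hom := by
    rw [braiding_naturality_right, SymmetricCategory.symmetry_assoc]
  have hl : A ◁ η_ U (Uᘁ : C) ≫ (α_ A U (Uᘁ)).inv ≫ (β_ (A ⊗ U) (Uᘁ)).hom =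
      (A ◁ (η_ U (Uᘁ) ≫ (β_ U (Uᘁ)).hom) ≫ (α_ A (Uᘁ) U).inv ≫ (β_ A (Uᘁ)).hom ▷ U) ≫
        (α_ _ _ _).hom := by
    simp [braiding_tensor_left_hom]
  have hr : (β_ (Uᘁ) (B ⊗ U)).hom ≫ (α_ B U (Uᘁ)).hom ≫ B ◁ ((β_ U (Uᘁ)).hom ≫ ε_ U (Uᘁ)) =
      (α_ _ _ _).inv ≫ (β_ (Uᘁ : C) B).hom ▷ U ≫ (α_ B (Uᘁ) U).hom ≫ B ◁ ε_ U (Uᘁ) := by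
    simp only [braiding_tensor_right_hom, Category.assoc, Iso.inv_hom_id_assoc,
      ← MonoidalCategory.whiskerLeft_comp, SymmetricCategory.symmetry_assoc]
  rw [ptrace, hf]
  simp only [Category.assoc]
  rw [reassoc_of% hl, reassoc_of% hr,
    reassoc_of% (whiskerLeft_braiding_whiskerRight (η_ U (Uᘁ) ≫ (β_ U (Uᘁ)).hom) A),
    reassoc_of% (braiding_whiskerRight_whiskerLeft (ε_ U (Uᘁ)) B)]
  simp [leftTrace]

end LeftTrace

section Permutations

open Equiv

/-- The embedding of `S_m` into `S_{m+1}` as the stabilizer of `0`. -/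
def shiftPerm (m : ℕ) : Perm (Fin m) →* Perm (Fin (m + 1)) :=
  Perm.extendDomainHom (finSuccAboveEquiv (0 : Fin (m + 1)))

@[simp]
lemma shiftPerm_apply_zero {m : ℕ} (σ : Perm (Fin m)) : shiftPerm m σ 0 = 0 :=
  Perm.extendDomain_apply_not_subtype _ _ (by simp)

@[simp]
lemma shiftPerm_apply_succ {m : ℕ} (σ : Perm (Fin m)) (i : Fin m) :
    shiftPerm m σ i.succ = (σ i).succ :=
  Perm.extendDomain_apply_image σ (finSuccAboveEquiv (0 : Fin (m + 1))) i

lemma shiftPerm_swap {m : ℕ} (i j : Fin m) : shiftPerm m (swap i j) = swap i.succ j.succ := by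
  ext x
  cases x using Fin.cases with
  | zero => simp [swap_apply_of_ne_of_ne (Fin.succ_ne_zero _).symm (Fin.succ_ne_zero _).symm]
  | succ x => simp [Function.Injective.swap_apply (Fin.succ_injective m)]

lemma swap_mul_shiftPerm_shiftPerm {m : ℕ} (σ : Perm (Fin m)) :
    swap 0 1 * shiftPerm (m + 1) (shiftPerm m σ) =
      shiftPerm (m + 1) (shiftPerm m σ) * swap 0 1 := by
  have h : shiftPerm (m + 1) (shiftPerm m σ) 1 = 1 := by
    simpa using shiftPerm_apply_succ (shiftPerm m σ) 0
  rw [mul_swap_eq_swap_mul, h, shiftPerm_apply_zero]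

lemma swap_braid (m : ℕ) :
    (swap 0 1 : Perm (Fin (m + 3))) * shiftPerm (m + 2) (swap 0 1) * swap 0 1 =
      shiftPerm (m + 2) (swap 0 1) * swap 0 1 * shiftPerm (m + 2) (swap 0 1) := by
  have h₁ : (0 : Fin (m + 2)).succ = 1 := rfl
  have h₂ : (1 : Fin (m + 2)).succ = 2 := rfl
  have h₀₁ : (0 : Fin (m + 3)) ≠ 1 := by simp
  have h₀₂ : (0 : Fin (m + 3)) ≠ 2 := Fin.succ_ne_zero 1 |>.symm
  have h₁₂ : (2 : Fin (m + 3)) ≠ 1 := by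
    rw [← h₂, ← h₁, Ne, Fin.succ_inj]
    simp
  rw [shiftPerm_swap, h₁, h₂, swap_mul_swap_mul_swap h₀₁ h₀₂, swap_comm 0 1, swap_comm 1 2,
    swap_mul_swap_mul_swap h₁₂ h₀₂.symm, swap_comm]

/-- Multiplying by a transposition that turns `x` into a fixed point splits off a cycle. -/
lemma card_cycleType_swap_mul {α : Type*} [Fintype α] [DecidableEq α] (σ : Perm α) (x : α)
    (hx : σ x ≠ x) :
    Multiset.card (swap x (σ x) * σ).cycleType + σ.cycleType.sum =
      Multiset.card σ.cycleType + (swap x (σ x) * σ).cycleType.sum + 1 := by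
  set c := σ.cycleOf x with hc
  have hcx : c x = σ x := Perm.cycleOf_apply_self σ x
  have hcyc : c.IsCycle := Perm.isCycle_cycleOf σ hx
  have hdisj : (σ * c⁻¹).Disjoint c :=
    Perm.disjoint_mul_inv_of_mem_cycleFactorsFinset
      (Perm.cycleOf_mem_cycleFactorsFinset_iff.2 (Perm.mem_support.2 hx))
  set r := σ * c⁻¹ with hr
  have hσ : σ = c * r := by rw [← hdisj.commute.eq, hr, inv_mul_cancel_right]
  have hσt : σ.cycleType = c.cycleType + r.cycleType := by
    rw [hσ, hdisj.symm.cycleType_mul]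
  by_cases hcc : c (c x) = x
  · have hs : c = swap x (c x) :=
      hcyc.eq_swap_of_apply_apply_eq_self (by rwa [hcx]) hcc
    have hτ : swap x (σ x) * σ = r := by
      rw [← hcx, ← hs, hσ, ← mul_assoc, hs, swap_mul_self, one_mul]
    have h2 : c.support.card = 2 := by
      rw [hs, Perm.card_support_swap (by rw [hcx]; exact hx.symm)]
    rw [hτ, hσt, hcyc.cycleType, h2]
    simp
    omega
  · have hc' := hcyc.swap_mul (by rwa [hcx]) hcc
    have hsupp := Perm.support_swap_mul_eq c x hcc
    have hτ : swap x (σ x) * σ = (swap x (c x) * c) * r := by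
      rw [hcx, mul_assoc, ← hσ]
    have hdisj' : (swap x (c x) * c).Disjoint r := by
      rw [Perm.disjoint_iff_disjoint_support, hsupp]
      exact (Perm.disjoint_iff_disjoint_support.1 hdisj.symm).mono_left Finset.sdiff_subset
    have hcard : (swap x (c x) * c).support.card + 1 = c.support.card := by
      rw [hsupp, Finset.sdiff_singleton_eq_erase, Finset.card_erase_add_one]
      rw [Perm.mem_support, hcx]
      exact hx
    rw [hτ, hdisj'.cycleType_mul, hσt, hcyc.cycleType, hc'.cycleType, ← hcard]
    simp
    omega

lemma numCycles_shiftPerm {m : ℕ} (σ : Perm (Fin m)) :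
    numCycles (shiftPerm m σ) = numCycles σ + 1 := by
  have h : (shiftPerm m σ).cycleType = σ.cycleType :=
    Perm.cycleType_extendDomain (finSuccAboveEquiv (0 : Fin (m + 1)))
  have hle : σ.cycleType.sum ≤ m := by simpa using σ.sum_cycleType_le
  simp only [numCycles, h]
  omega

lemma numCycles_swap_mul_shiftPerm {m : ℕ} (σ : Perm (Fin (m + 1))) :
    numCycles (swap 0 1 * shiftPerm (m + 1) σ) = numCycles σ := by
  have hs := numCycles_shiftPerm σ
  have hle := (shiftPerm (m + 1) σ).sum_cycleType_le
  set π : Perm (Fin (m + 2)) := swap 0 1 * shiftPerm (m + 1) σ with hπ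
  have hπ0 : π 0 = 1 := by simp [hπ]
  have h := card_cycleType_swap_mul π 0 (by simp [hπ0])
  rw [hπ0, hπ, swap_mul_self_mul, ← hπ] at h
  have hle' := π.sum_cycleType_le
  simp only [Fintype.card_fin] at hle hle'
  simp only [numCycles] at hs ⊢
  omega

lemma numCycles_conj {m : ℕ} (σ τ : Perm (Fin m)) : numCycles (τ * σ * τ⁻¹) = numCycles σ := by
  simp only [numCycles, Perm.cycleType_conj]

lemma numCycles_shiftPerm_mul_swap_mul_shiftPerm {m : ℕ} (σ τ : Perm (Fin (m + 1))) :
    numCycles (shiftPerm (m + 1) σ * swap 0 1 * shiftPerm (m + 1) τ) = numCycles (σ * τ) := by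
  rw [← numCycles_conj _ (shiftPerm (m + 1) σ)⁻¹]
  rw [← numCycles_conj (σ * τ) σ⁻¹, ← numCycles_swap_mul_shiftPerm (σ⁻¹ * _ * _)]
  simp only [map_mul, inv_inv, mul_assoc, inv_mul_cancel_left]

lemma numCycles_pos {m : ℕ} (σ : Perm (Fin (m + 1))) : 0 < numCycles σ := by
  rw [numCycles]
  by_contra! h
  have h1 : σ.cycleType = 0 := by
    rw [← Multiset.card_eq_zero]; omega
  simp [h1] at h

end Permutations

section PermMor

open Equiv BraidedCategory ExactPairing

section Braided

variable [BraidedCategory C] (X W : C)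

/-- The braiding of the first two factors of `X ⊗ X ⊗ W`. -/
def swapFirst : X ⊗ X ⊗ W ⟶ X ⊗ X ⊗ W :=
  (α_ X X W).inv ≫ (β_ X X).hom ▷ W ≫ (α_ X X W).hom

lemma swapFirst_comp_whiskerLeft {W : C} (f : W ⟶ W) :
    swapFirst X W ≫ X ◁ X ◁ f = X ◁ X ◁ f ≫ swapFirst X W := by
  simp only [swapFirst, Category.assoc]
  rw [← associator_naturality_right, ← whisker_exchange_assoc,
    ← associator_inv_naturality_right_assoc]

lemma swapFirst_braid :
    swapFirst X (X ⊗ W) ≫ X ◁ swapFirst X W ≫ swapFirst X (X ⊗ W) =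
      X ◁ swapFirst X W ≫ swapFirst X (X ⊗ W) ≫ X ◁ swapFirst X W := by
  have h := congrArg (fun t ↦ (α_ X X (X ⊗ W)).inv ≫ (α_ (X ⊗ X) X W).inv ≫
    ((α_ X X X).hom ≫ t ≫ (α_ X X X).inv) ▷ W ≫
      (α_ (X ⊗ X) X W).hom ≫ (α_ X X (X ⊗ W)).hom) (yang_baxter X X X)
  simp only [swapFirst]
  convert h using 1
  · monoidal
  · monoidal

/-- `IsPermMor X m σ f` says that `f` is obtained from `σ` by writing `σ` recursively in terms of
the double cosets of `S_m` in `S_{m+1}`. -/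
inductive IsPermMor (X : C) : (m : ℕ) → Perm (Fin m) → (tpow X m ⟶ tpow X m) → Prop
  | zero : IsPermMor X 0 1 (𝟙 _)
  | shift {m : ℕ} {σ : Perm (Fin m)} {f : tpow X m ⟶ tpow X m} (hf : IsPermMor X m σ f) :
      IsPermMor X (m + 1) (shiftPerm m σ) (X ◁ f)
  | shift_swap_shift {m : ℕ} {σ τ : Perm (Fin (m + 1))} {f g : tpow X (m + 1) ⟶ tpow X (m + 1)}
      (hf : IsPermMor X (m + 1) σ f) (hg : IsPermMor X (m + 1) τ g) :
      IsPermMor X (m + 2) (shiftPerm (m + 1) σ * swap 0 1 * shiftPerm (m + 1) τ)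
        (X ◁ g ≫ swapFirst X (tpow X m) ≫ X ◁ f)

end Braided

section Symmetric

variable [SymmetricCategory C] {X : C}

@[simp]
lemma swapFirst_comp_self (X W : C) : swapFirst X W ≫ swapFirst X W = 𝟙 _ := by
  simp only [swapFirst, Category.assoc, Iso.hom_inv_id_assoc]
  rw [← comp_whiskerRight_assoc, SymmetricCategory.symmetry]
  simp

namespace IsPermMor

lemma congr {m : ℕ} {σ τ : Perm (Fin m)} {f g : tpow X m ⟶ tpow X m} (h : IsPermMor X m σ f)
    (hσ : σ = τ) (hf : f = g) : IsPermMor X m τ g :=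
  hσ ▸ hf ▸ h

lemma one (m : ℕ) : IsPermMor X m 1 (𝟙 _) := by
  induction m with
  | zero => exact .zero
  | succ m ih => exact ih.shift.congr (map_one _) (MonoidalCategory.whiskerLeft_id _ _)

/-- Left multiplication by an element of `S_m`, given closure under multiplication in `S_m`. -/
lemma shift_mul {m : ℕ}
    (hmul : ∀ {σ τ : Perm (Fin m)} {f g}, IsPermMor X m σ f → IsPermMor X m τ g →
      IsPermMor X m (σ * τ) (g ≫ f))
    {σ : Perm (Fin m)} {τ : Perm (Fin (m + 1))} {f g} (hf : IsPermMor X m σ f)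
    (hg : IsPermMor X (m + 1) τ g) : IsPermMor X (m + 1) (shiftPerm m σ * τ) (g ≫ X ◁ f) := by
  cases hg with
  | shift hg =>
    exact (hmul hf hg).shift.congr (map_mul _ _ _) (MonoidalCategory.whiskerLeft_comp _ _ _)
  | shift_swap_shift hg hg' =>
    have aux {W : C} (a : X ⊗ W ⟶ X ⊗ W) (b c : X ⊗ W ⟶ X ⊗ W) :
        X ◁ c ≫ swapFirst X W ≫ X ◁ (b ≫ a) = (X ◁ c ≫ swapFirst X W ≫ X ◁ b) ≫ X ◁ a := by
      simp
    exact ((hmul hf hg).shift_swap_shift hg').congr (by simp only [map_mul, mul_assoc])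
      (aux _ _ _)

/-- Left multiplication by `swap 0 1`, given closure under multiplication in `S_{m+1}`. -/
lemma swap_mul {m : ℕ}
    (hmul : ∀ {σ τ : Perm (Fin (m + 1))} {f g}, IsPermMor X (m + 1) σ f → IsPermMor X (m + 1) τ g →
      IsPermMor X (m + 1) (σ * τ) (g ≫ f))
    {τ : Perm (Fin (m + 2))} {g} (hg : IsPermMor X (m + 2) τ g) :
    IsPermMor X (m + 2) (swap 0 1 * τ) (g ≫ swapFirst X (tpow X m)) := by
  cases hg with
  | shift hg =>
    have aux {W : C} (g : X ⊗ W ⟶ X ⊗ W) :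
        X ◁ g ≫ swapFirst X W ≫ X ◁ 𝟙 (X ⊗ W) = X ◁ g ≫ swapFirst X W := by simp
    exact ((one (m + 1)).shift_swap_shift hg).congr (by simp) (aux _)
  | @shift_swap_shift _ σ τ _ g hσ hg =>
    cases hσ with
    | @shift _ σ f hf =>
      have aux {W : C} (g : X ⊗ W ⟶ X ⊗ W) (f : W ⟶ W) : X ◁ (g ≫ X ◁ f) =
          (X ◁ g ≫ swapFirst X W ≫ X ◁ X ◁ f) ≫ swapFirst X W := by
        simp only [Category.assoc, ← swapFirst_comp_whiskerLeft,
          reassoc_of% (swapFirst_comp_self X W), MonoidalCategory.whiskerLeft_comp]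
      refine (hmul hf.shift hg).shift.congr ?_ (aux _ _)
      rw [← mul_assoc, ← mul_assoc, swap_mul_shiftPerm_shiftPerm, mul_assoc, mul_assoc,
        swap_mul_self_mul, map_mul]
    | @shift_swap_shift m σ₁ σ₂ f₁ f₂ hf₁ hf₂ =>
      have aux {W : C} (g : X ⊗ X ⊗ W ⟶ X ⊗ X ⊗ W) (f₁ f₂ : X ⊗ W ⟶ X ⊗ W) :
          X ◁ ((g ≫ X ◁ f₂) ≫ swapFirst X W) ≫ swapFirst X (X ⊗ W) ≫
            X ◁ (swapFirst X W ≫ X ◁ f₁) =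
          (X ◁ g ≫ swapFirst X (X ⊗ W) ≫ X ◁ (X ◁ f₂ ≫ swapFirst X W ≫ X ◁ f₁)) ≫
            swapFirst X (X ⊗ W) := by
        have h := swapFirst_braid X W
        simp only [MonoidalCategory.whiskerLeft_comp, Category.assoc,
          ← swapFirst_comp_whiskerLeft]
        rw [reassoc_of% (swapFirst_comp_whiskerLeft (X := X) f₂), reassoc_of% h]
      have hs : IsPermMor X (m + 2) (swap 0 1) (swapFirst X (tpow X m)) :=
        ((one (m + 1)).shift_swap_shift (one (m + 1))).congr (by simp)
          ((by simp : ∀ (W : C), X ◁ 𝟙 _ ≫ swapFirst X W ≫ X ◁ 𝟙 (X ⊗ W) = swapFirst X W) _)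
      refine ((hmul hf₁.shift hs).shift_swap_shift
        (hmul hs (hmul hf₂.shift hg))).congr ?_ (aux _ _ _)
      have aux' {G : Type} [Group G] {s t x y : G} (z : G) (hx : s * x = x * s)
          (hy : s * y = y * s) (hb : s * t * s = t * s * t) :
          x * t * s * (t * (y * z)) = s * (x * t * y * s * z) := by
        calc _ = x * (t * s * t) * y * z := by group
          _ = (s * x) * t * (y * s) * z := by rw [hx, ← hy, ← hb]; group
          _ = _ := by group
      simp only [map_mul]
      exact aux' _ (swap_mul_shiftPerm_shiftPerm _) (swap_mul_shiftPerm_shiftPerm _)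
        (swap_braid m)

lemma mul {m : ℕ} {σ τ : Perm (Fin m)} {f g} (hf : IsPermMor X m σ f) (hg : IsPermMor X m τ g) :
    IsPermMor X m (σ * τ) (g ≫ f) := by
  induction m with
  | zero =>
    cases hf; cases hg
    exact (one 0).congr (mul_one _).symm (Category.comp_id _).symm
  | succ m ih =>
    cases hf with
    | shift hf => exact shift_mul ih hf hg
    | shift_swap_shift hf hf' =>
      refine (shift_mul ih hf (swap_mul ih (shift_mul ih hf' hg))).congr
        (by simp only [mul_assoc]) ?_
      exact (by simp : ∀ {Z : C} (a b c d : Z ⟶ Z), ((a ≫ b) ≫ c) ≫ d = a ≫ b ≫ c ≫ d) _ _ _ _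

lemma swap_zero_one (m : ℕ) : IsPermMor X (m + 2) (swap 0 1) (swapFirst X (tpow X m)) :=
  (swap_mul mul (one (m + 2))).congr (mul_one _) (Category.id_comp _)

lemma adjSwap {m : ℕ} (i : ℕ) (h : i + 1 < m) :
    IsPermMor X m (swap ⟨i, Nat.lt_of_succ_lt h⟩ ⟨i + 1, h⟩) (adjSwap X m i) := by
  induction i generalizing m with
  | zero =>
    obtain ⟨m, rfl⟩ : ∃ n, m = n + 2 := ⟨m - 2, by omega⟩
    exact swap_zero_one m
  | succ i ih =>
    obtain ⟨m, rfl⟩ : ∃ n, m = n + 2 := ⟨m - 2, by omega⟩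
    have := (ih (m := m + 1) (by omega)).shift
    rw [shiftPerm_swap] at this
    exact this

end IsPermMor

lemma IsPermAction.isPermMor {m : ℕ} {ρ : Perm (Fin (m + 1)) →* End (tpow X (m + 1))}
    (hρ : IsPermAction X (m + 1) ρ) (σ : Perm (Fin (m + 1))) :
    IsPermMor X (m + 1) σ (ρ σ) := by
  have hσ : σ ∈ Submonoid.closure (Set.range fun i : Fin m ↦ swap i.castSucc i.succ) := by
    simp [Perm.mclosure_swap_castSucc_succ]
  induction hσ using Submonoid.closure_induction with
  | mem x hx =>
    obtain ⟨i, rfl⟩ := hx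
    have h : i.val + 1 < m + 1 := by omega
    exact (IsPermMor.adjSwap i.val h).congr rfl (hρ i.val h).symm
  | one => exact (IsPermMor.one _).congr rfl (map_one ρ).symm
  | mul x y _ _ hx hy => exact (hx.mul hy).congr rfl (map_mul ρ x y).symm

lemma leftTrace_swapFirst (X W : C) {V : C} [ExactPairing X V] :
    leftTrace V (swapFirst X W) = 𝟙 (X ⊗ W) := by
  rw [swapFirst, leftTrace_whiskerRight, leftTrace_braiding, id_whiskerRight]

lemma leftTrace_shift_swap_shift {W V : C} [ExactPairing X V] (f g : X ⊗ W ⟶ X ⊗ W) :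
    leftTrace V (X ◁ g ≫ swapFirst X W ≫ X ◁ f) = g ≫ f := by
  rw [leftTrace_whiskerLeft_comp, leftTrace_comp_whiskerLeft, leftTrace_swapFirst,
    Category.id_comp]

lemma leftTrace_whiskerLeft {k : Type*} [Field k] [Preadditive C] [Linear k C]
    [MonoidalPreadditive C] [MonoidalLinear k C] {V W W' : C} [ExactPairing X V] {d : k}
    (hd : η_ X V ≫ (β_ X V).hom ≫ ε_ X V = d • 𝟙 (𝟙_ C)) (f : W ⟶ W') :
    leftTrace V (X ◁ f) = d • f := by
  have h := leftTrace_comp_whiskerLeft (V := V) (𝟙 (X ⊗ W)) f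
  rw [Category.id_comp, leftTrace_id, hd] at h
  simpa using h

end Symmetric

section Rigid

variable [SymmetricCategory C] [RigidCategory C]

lemma ptrace_tensor (X U : C) (h : X ⊗ X ⊗ U ⟶ X ⊗ X ⊗ U) :
    ptrace X X (X ⊗ U) (swapFirst X U ≫ h ≫ swapFirst X U) =
      ptrace X X U (leftTrace (Xᘁ : C) h) := by
  rw [ptrace_eq_leftTrace, ptrace_eq_leftTrace,
    leftTrace_eq_of_exactPairing _
      (ExactPairing.tensor (X₁ := X) (X₂ := U) (Y₁ := Xᘁ) (Y₂ := Uᘁ)), leftTrace_tensor,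
    ← leftTrace_comp_whiskerLeft, ← leftTrace_whiskerLeft_comp]
  have h₁ : (β_ (X ⊗ U) X).hom = (α_ X U X).hom ≫ X ◁ (β_ U X).hom ≫ swapFirst X U := by
    rw [braiding_tensor_left_hom, swapFirst]
  have h₂ : (β_ X (X ⊗ U)).hom = swapFirst X U ≫ X ◁ (β_ X U).hom ≫ (α_ X U X).inv := by
    rw [braiding_tensor_right_hom, swapFirst]
    simp
  simp [h₁, h₂, reassoc_of% (swapFirst_comp_self X U)]

lemma ptrace_unit_id (X : C) : ptrace X X (𝟙_ C) (𝟙 (X ⊗ 𝟙_ C)) = 𝟙 X := by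
  rw [ptrace_eq_leftTrace, Category.id_comp, SymmetricCategory.symmetry,
    leftTrace_eq_of_exactPairing _ exactPairingUnit, leftTrace_id]
  have h : η_ (𝟙_ C) (𝟙_ C) ≫ (β_ (𝟙_ C) (𝟙_ C)).hom ≫ ε_ (𝟙_ C) (𝟙_ C) = 𝟙 _ := by
    rw [braiding_tensorUnit_left]
    change (ρ_ _).inv ≫ _ ≫ (ρ_ _).hom = _
    simp [unitors_equal]
  rw [h]
  simp

variable {k : Type*} [Field k] [Preadditive C] [Linear k C] [MonoidalPreadditive C]
  [MonoidalLinear k C]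

lemma ptrace_smul (A B U : C) (a : k) (f : A ⊗ U ⟶ B ⊗ U) :
    ptrace A B U (a • f) = a • ptrace A B U f := by
  simp [ptrace]

lemma IsPermMor.ptrace {X : C} {d : k}
    (hd : η_ X (Xᘁ) ≫ (β_ X (Xᘁ)).hom ≫ ε_ X (Xᘁ) = d • 𝟙 (𝟙_ C)) {m : ℕ}
    {σ : Perm (Fin (m + 1))} {f} (hf : IsPermMor X (m + 1) σ f) :
    ptrace X X (tpow X m) f = d ^ (numCycles σ - 1) • 𝟙 X := by
  induction m with
  | zero =>
    have hσ : σ = 1 := Subsingleton.elim (α := Perm (Fin 1)) _ _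
    cases hf with
    | shift hf =>
    cases hf
    have h : numCycles (1 : Perm (Fin 1)) - 1 = 0 := by simp [numCycles]
    have h' : _root_.ptrace X X (𝟙_ C) (X ◁ 𝟙 (𝟙_ C)) = 𝟙 X := by
      rw [MonoidalCategory.whiskerLeft_id, ptrace_unit_id]
    rw [hσ, h, pow_zero, one_smul]
    exact h'
  | succ m ih =>
    have hs := swap_zero_one (X := X) m
    have hg := (hs.mul hf).mul hs
    have aux {W : C} (f : X ⊗ X ⊗ W ⟶ X ⊗ X ⊗ W) : _root_.ptrace X X (X ⊗ W) f =
        _root_.ptrace X X W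
          (leftTrace (Xᘁ : C) (swapFirst X W ≫ f ≫ swapFirst X W)) := by
      simp [← ptrace_tensor, reassoc_of% (swapFirst_comp_self X W)]
    have key {π : Perm (Fin (m + 2))} {g : tpow X (m + 2) ⟶ tpow X (m + 2)}
        (hg : IsPermMor X (m + 2) π g) :
        _root_.ptrace X X (tpow X m) (leftTrace (U := X) (W := X ⊗ tpow X m)
          (W' := X ⊗ tpow X m) (Xᘁ : C) g) = d ^ (numCycles π - 1) • 𝟙 X := by
      cases hg with
      | @shift _ τ g hg =>
        refine (congrArg _ (leftTrace_whiskerLeft hd (W := X ⊗ tpow X m) g)).trans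
          ((ptrace_smul _ _ _ _ _).trans ?_)
        refine (congrArg _ (ih hg)).trans ?_
        rw [smul_smul, ← pow_succ', numCycles_shiftPerm, Nat.add_sub_cancel,
          Nat.sub_add_cancel (numCycles_pos τ)]
      | shift_swap_shift hg₁ hg₂ =>
        rw [numCycles_shiftPerm_mul_swap_mul_shiftPerm, ← ih (hg₁.mul hg₂)]
        congr 1
        exact leftTrace_shift_swap_shift _ _
    have hN := numCycles_conj σ (swap 0 1)
    rw [swap_inv] at hN
    rw [← hN]
    refine (aux _).trans ?_
    exact key hg

end Rigid

end PermMor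

/-- Let `C` be a `k`-linear symmetric rigid monoidal category with
`End (𝟙_ C) = k`, let `X : C` have dimension `d = ẽv_X ∘ coev_X ∈ k`, and view
`X^{⊗(m+1)}` as `X ⊗ X^{⊗m}`.  Then for the action `ρ` of `S_{m+1}` on
`X^{⊗(m+1)}` permuting the tensor factors via the symmetry and any `σ ∈ S_{m+1}`,
`Tr^{X^{⊗m}}_{X,X}(ρ σ) = d^{N(σ)-1} • id_X`, where `N(σ)` is the number of disjoint
cycles of `σ` (fixed points counted as cycles). -/
theorem ptrace_perm
    {k : Type*} [Field k] [Preadditive C] [Linear k C]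
    [MonoidalPreadditive C] [MonoidalLinear k C]
    [SymmetricCategory C] [RigidCategory C]
    (hEnd : Function.Bijective (fun a : k => a • (𝟙 (𝟙_ C))))
    (X : C) (d : k)
    (hd : η_ X (Xᘁ) ≫ (β_ X (Xᘁ)).hom ≫ ε_ X (Xᘁ) = d • 𝟙 (𝟙_ C))
    (m : ℕ)
    (ρ : Equiv.Perm (Fin (m + 1)) →* CategoryTheory.End (tpow X (m + 1)))
    (hρ : IsPermAction X (m + 1) ρ) (σ : Equiv.Perm (Fin (m + 1))) :
    ptrace X X (tpow X m) (ρ σ) = d ^ (numCycles σ - 1) • 𝟙 X := by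
  exact (hρ.isPermMor σ).ptrace hd
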